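/- The map F₂ : ℝ³ → ℝ³ defined by F₂(α,β,γ) = (αβ − γ², α − β, 2γ), restricted to the solid cone C = {(α,β,γ) : α ≥ 0, β ≥ 0, αβ ≥ γ²}, is a bijection from C onto [0,∞) × ℝ × ℝ, and it is a homeomorphism with respect to the subspace topologies. -/

import Mathlib

/-- The map `F₂(α,β,γ) = (αβ − γ², α − β, 2γ)`. -/
def F2 (x : ℝ × ℝ × ℝ) : ℝ × ℝ × ℝ :=
  (x.1 * x.2.1 - x.2.2 ^ 2, x.1 - x.2.1, 2 * x.2.2)

/-- The solid cone `C = {(α,β,γ) : α ≥ 0, β ≥ 0, αβ ≥ γ²}`. -/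
def solidCone : Set (ℝ × ℝ × ℝ) :=
  {y | 0 ≤ y.1 ∧ 0 ≤ y.2.1 ∧ y.2.2 ^ 2 ≤ y.1 * y.2.1}

/-- The inverse of `F2` on the solid cone, recovering `α + β` as `√(4p + q² + r²)`. -/
noncomputable def F2Inv (y : ℝ × ℝ × ℝ) : ℝ × ℝ × ℝ :=
  ((√(4 * y.1 + y.2.1 ^ 2 + y.2.2 ^ 2) + y.2.1) / 2,
    (√(4 * y.1 + y.2.1 ^ 2 + y.2.2 ^ 2) - y.2.1) / 2, y.2.2 / 2)

theorem continuous_F2 : Continuous F2 := by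
  unfold F2
  fun_prop

theorem continuous_F2Inv : Continuous F2Inv := by
  unfold F2Inv
  fun_prop

theorem mapsTo_F2 : Set.MapsTo F2 solidCone {y : ℝ × ℝ × ℝ | 0 ≤ y.1} :=
  fun _ hx => sub_nonneg.mpr hx.2.2

theorem mapsTo_F2Inv : Set.MapsTo F2Inv {y : ℝ × ℝ × ℝ | 0 ≤ y.1} solidCone := by
  rintro ⟨p, q, r⟩ (hp : 0 ≤ p)
  have hq : |q| ≤ √(4 * p + q ^ 2 + r ^ 2) :=
    Real.abs_le_sqrt (by nlinarith [sq_nonneg r])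
  have hs : √(4 * p + q ^ 2 + r ^ 2) ^ 2 = 4 * p + q ^ 2 + r ^ 2 :=
    Real.sq_sqrt (by positivity)
  obtain ⟨h₁, h₂⟩ := abs_le.mp hq
  refine ⟨?_, ?_, ?_⟩ <;> dsimp only [F2Inv]
  · linarith
  · linarith
  · nlinarith

theorem leftInvOn_F2Inv_F2 : Set.LeftInvOn F2Inv F2 solidCone := by
  rintro ⟨a, b, c⟩ ⟨ha, hb, -⟩
  dsimp only at ha hb
  have hs : √(4 * (a * b - c ^ 2) + (a - b) ^ 2 + (2 * c) ^ 2) = a + b := by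
    rw [show 4 * (a * b - c ^ 2) + (a - b) ^ 2 + (2 * c) ^ 2 = (a + b) ^ 2 by ring]
    exact Real.sqrt_sq (add_nonneg ha hb)
  simp only [F2, F2Inv, hs, Prod.mk.injEq]
  refine ⟨?_, ?_, ?_⟩ <;> ring

theorem rightInvOn_F2Inv_F2 : Set.RightInvOn F2Inv F2 {y : ℝ × ℝ × ℝ | 0 ≤ y.1} := by
  rintro ⟨p, q, r⟩ (hp : 0 ≤ p)
  have hs : √(4 * p + q ^ 2 + r ^ 2) ^ 2 = 4 * p + q ^ 2 + r ^ 2 :=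
    Real.sq_sqrt (by positivity)
  simp only [F2, F2Inv, Prod.mk.injEq]
  refine ⟨?_, ?_, ?_⟩
  · linear_combination hs / 4
  · ring
  · ring

/-- `F₂` restricted to the solid cone `C` is a bijection from `C` onto
`[0,∞) × ℝ × ℝ`, and a homeomorphism with respect to the subspace topologies. -/
theorem F2_bijOn_and_homeomorph :
    Set.BijOn F2 solidCone {y : ℝ × ℝ × ℝ | 0 ≤ y.1} ∧
    ∃ h : solidCone ≃ₜ {y : ℝ × ℝ × ℝ | 0 ≤ y.1},
      ∀ x : solidCone, (h x : ℝ × ℝ × ℝ) = F2 x := by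
  refine ⟨Set.InvOn.bijOn ⟨leftInvOn_F2Inv_F2, rightInvOn_F2Inv_F2⟩ mapsTo_F2 mapsTo_F2Inv,
    { toFun := mapsTo_F2.restrict
      invFun := mapsTo_F2Inv.restrict
      left_inv := fun x => Subtype.ext (leftInvOn_F2Inv_F2 x.2)
      right_inv := fun y => Subtype.ext (rightInvOn_F2Inv_F2 y.2)
      continuous_toFun := continuous_F2.continuousOn.mapsToRestrict mapsTo_F2
      continuous_invFun := continuous_F2Inv.continuousOn.mapsToRestrict mapsTo_F2Inv },
    fun _ => rfl⟩
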